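/- (Lemma 2.2, case b) Let 1 ≤ k ≤ m, let y ∈ ℝ^m be sorted in nonincreasing order with T_k(y) > 0, let ȳ := proj_{B_k}(y) have index pair (k̄0, k̄1) associated with k and partition (ᾱ, β̄, γ̄), and let (ȳ, μ̄, λ̄, θ̄) satisfy the projection KKT conditions. Assume k < k̄1 and y_{k̄0+1} − λ̄ < θ̄ < y_{k̄1}. Define C ∈ ℝ^{(|β̄|−1)×|β̄|} as the forward-difference matrix whose i-th row is e_i^⊤ − e_{i+1}^⊤, and B := [1_ᾱ^⊤ μ̄_β̄^⊤ ; 0 C] ∈ ℝ^{(|ᾱ|+|β̄|−1)×(|ᾱ|+|β̄|)}. Then B B^⊤ is invertible, and the Jacobian of proj_{B_k} at y is the block-diagonal matrix diag( I_{|ᾱ|+|β̄|} − B^⊤(B B^⊤)^{−1} B , I_{|γ̄|} ). -/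

import Mathlib

open Filter Topology Matrix

noncomputable def topkSum {ι : Type*} [Fintype ι] (k : ℕ) (x : ι → ℝ) : ℝ :=
  sSup {v : ℝ | ∃ s : Finset ι, s.card = k ∧ v = ∑ i ∈ s, x i}

def Bk (m k : ℕ) : Set (Fin m → ℝ) := {x | topkSum k x ≤ 0}

noncomputable def sortDesc {m : ℕ} (x : Fin m → ℝ) : Fin m → ℝ :=
  fun i => (x ∘ Tuple.sort x) i.rev

noncomputable def ent {m : ℕ} (x : Fin m → ℝ) (i : ℕ) : ℝ :=
  if h : 1 ≤ i ∧ i ≤ m then x ⟨i - 1, by omega⟩ else 0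

noncomputable def entE {m : ℕ} (x : Fin m → ℝ) (i : ℕ) : EReal :=
  if h : 1 ≤ i ∧ i ≤ m then ((x ⟨i - 1, by omega⟩ : ℝ) : EReal)
  else if i = 0 then ⊤ else ⊥

def IsIndexPairOf {m : ℕ} (k : ℕ) (x : Fin m → ℝ) (k0 k1 : ℕ) : Prop :=
  k0 + 1 ≤ k ∧ k ≤ k1 ∧ k1 ≤ m ∧
  entE x (k0 + 1) < entE x k0 ∧
  (∀ i : ℕ, k0 + 1 ≤ i → i ≤ k1 → entE x i = entE x k) ∧
  entE x (k1 + 1) < entE x k1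

def IsEProjOn {m : ℕ} (S : Set (Fin m → ℝ)) (y p : Fin m → ℝ) : Prop :=
  p ∈ S ∧ ∀ z ∈ S, ∑ i, (y i - p i) ^ 2 ≤ ∑ i, (y i - z i) ^ 2

def ProjKKT {m : ℕ} (k : ℕ) (y ybar μ : Fin m → ℝ) (lam θ : ℝ) (k0 k1 : ℕ) : Prop :=
  IsIndexPairOf k ybar k0 k1 ∧
  (∀ i : Fin m, (i : ℕ) < k0 → ybar i = y i - lam ∧ μ i = 1) ∧
  (∀ i : Fin m, k0 ≤ (i : ℕ) → (i : ℕ) < k1 →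
      ybar i = y i - lam * μ i ∧ ybar i = θ ∧ 0 ≤ μ i ∧ μ i ≤ 1) ∧
  (∑ i : Fin m, (if k0 ≤ (i : ℕ) ∧ (i : ℕ) < k1 then μ i else 0)) = (k : ℝ) - (k0 : ℝ) ∧
  (∀ i : Fin m, k1 ≤ (i : ℕ) → ybar i = y i ∧ μ i = 0) ∧
  (∑ i : Fin m, (if (i : ℕ) < k0 then y i else 0)) - (k0 : ℝ) * lam + ((k : ℝ) - (k0 : ℝ)) * θ = 0 ∧
  0 < lam ∧
  (θ : EReal) < entE ybar k0 ∧ entE ybar (k1 + 1) < (θ : EReal)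

noncomputable def cvar {m : ℕ} (τ : ℝ) (g : Fin m → ℝ) : ℝ :=
  ⨅ t : ℝ, t + (1 / ((1 - τ) * m)) * ∑ j, max (g j - t) 0

/-- The forward-difference matrix `C ∈ ℝ^{(b-1)×b}` whose `i`-th row is `eᵢᵀ - eᵢ₊₁ᵀ`. -/
def Cmat (b : ℕ) : Matrix (Fin (b - 1)) (Fin b) ℝ :=
  Matrix.of fun i j =>
    if (j : ℕ) = (i : ℕ) then 1 else if (j : ℕ) = (i : ℕ) + 1 then -1 else 0

/-- The matrix `B = [1_αᵀ μ_βᵀ ; 0 C]` with `|α| = a`, `|β| = b`. -/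
def Bmat (a b : ℕ) (μβ : Fin b → ℝ) : Matrix (Fin b) (Fin (a + b)) ℝ :=
  Matrix.of fun i j =>
    if hi : (i : ℕ) = 0 then
      (if hj : (j : ℕ) < a then 1 else μβ ⟨(j : ℕ) - a, by have := j.isLt; omega⟩)
    else
      (if hj : (j : ℕ) < a then 0
       else Cmat b ⟨(i : ℕ) - 1, by have := i.isLt; omega⟩
              ⟨(j : ℕ) - a, by have := j.isLt; omega⟩)

/-! ### Finite sums over initial segments of `Fin m` -/

lemma Fin.sum_dite_lt {m n : ℕ} (hn : n ≤ m) (f : Fin n → ℝ) :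
    ∑ j : Fin m, (if h : (j : ℕ) < n then f ⟨j, h⟩ else 0) = ∑ j, f j := by
  obtain ⟨d, rfl⟩ := Nat.exists_eq_add_of_le hn
  simp [Fin.sum_univ_add]

lemma Fin.sum_ite_lt_const {m n : ℕ} (hn : n ≤ m) (c : ℝ) :
    ∑ j : Fin m, (if (j : ℕ) < n then c else 0) = n * c := by
  simpa using Fin.sum_dite_lt hn (fun _ => c)

lemma Fin.sum_ite_lt_split {m n₀ n₁ : ℕ} (h : n₀ ≤ n₁) (f : Fin m → ℝ) :
    ∑ j : Fin m, (if (j : ℕ) < n₁ then f j else 0) =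
      ∑ j : Fin m, (if (j : ℕ) < n₀ then f j else 0) +
        ∑ j : Fin m, (if n₀ ≤ (j : ℕ) ∧ (j : ℕ) < n₁ then f j else 0) := by
  rw [← Finset.sum_add_distrib]
  refine Finset.sum_congr rfl fun j _ => ?_
  split_ifs <;> first | omega | simp

lemma Fin.sum_ite_between_const {m n₀ n₁ : ℕ} (h : n₀ ≤ n₁) (hn : n₁ ≤ m) (c : ℝ) :
    ∑ j : Fin m, (if n₀ ≤ (j : ℕ) ∧ (j : ℕ) < n₁ then c else 0) = ((n₁ : ℝ) - n₀) * c := by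
  have := Fin.sum_ite_lt_split h (fun _ : Fin m => c)
  rw [Fin.sum_ite_lt_const hn, Fin.sum_ite_lt_const (h.trans hn)] at this
  linarith

lemma Fin.sum_ite_between_eq {m n₀ n₁ : ℕ} (h : n₀ ≤ n₁) (hn : n₁ ≤ m) (f : Fin m → ℝ) :
    ∑ j : Fin m, (if n₀ ≤ (j : ℕ) ∧ (j : ℕ) < n₁ then f j else 0) =
      ∑ j : Fin (n₁ - n₀), f ⟨n₀ + j, by omega⟩ := by
  obtain ⟨d, rfl⟩ := Nat.exists_eq_add_of_le h
  have hd : n₀ + d - n₀ = d := by omega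
  have h1 := Fin.sum_dite_lt hn (fun j => f ⟨j, by omega⟩)
  have h2 := Fin.sum_dite_lt (h.trans hn) (fun j => f ⟨j, by omega⟩)
  have h3 := Fin.sum_ite_lt_split h f
  simp only [dite_eq_ite, Fin.eta] at h1 h2
  rw [Fin.sum_univ_add] at h1
  rw [h1, h2] at h3
  refine (add_left_cancel h3).symm.trans ?_
  refine Fintype.sum_equiv (finCongr hd.symm) _ _ fun j => ?_
  rfl

/-! ### The top-`k`-sum as a support function -/

lemma sum_mul_le_sum_mul_of_threshold {ι : Type*} [Fintype ι] {ν σ x : ι → ℝ} (t : ℝ)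
    (hsum : ∑ i, ν i = ∑ i, σ i) (h : ∀ i, (ν i - σ i) * (x i - t) ≤ 0) :
    ∑ i, ν i * x i ≤ ∑ i, σ i * x i := by
  have h1 : ∑ i, (ν i - σ i) * (x i - t) ≤ 0 := Finset.sum_nonpos fun i _ => h i
  have h2 : ∑ i, (ν i - σ i) * (x i - t) =
      ∑ i, ν i * x i - ∑ i, σ i * x i - t * (∑ i, ν i - ∑ i, σ i) := by
    rw [← Finset.sum_sub_distrib, ← Finset.sum_sub_distrib, Finset.mul_sum,
      ← Finset.sum_sub_distrib]
    exact Finset.sum_congr rfl fun i _ => by ring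
  rw [hsum] at h2
  linarith

lemma sum_le_topkSum {ι : Type*} [Fintype ι] (x : ι → ℝ) (s : Finset ι) :
    ∑ i ∈ s, x i ≤ topkSum s.card x := by
  refine le_csSup (Set.Finite.bddAbove ?_) ⟨s, rfl, rfl⟩
  refine (Set.finite_range fun s : Finset ι => ∑ i ∈ s, x i).subset ?_
  rintro v ⟨s, -, rfl⟩
  exact ⟨s, rfl⟩

lemma sum_mul_le_topkSum {ι : Type*} [Fintype ι] {k : ℕ} (hk : 1 ≤ k)
    (hkm : k ≤ Fintype.card ι) (x ν : ι → ℝ) (h0 : ∀ i, 0 ≤ ν i) (h1 : ∀ i, ν i ≤ 1)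
    (hsum : ∑ i, ν i = k) : ∑ i, ν i * x i ≤ topkSum k x := by
  classical
  obtain ⟨s, hs, hmax⟩ := Finset.exists_max_image (Finset.univ.powersetCard k)
    (fun s : Finset ι => ∑ i ∈ s, x i) (Finset.powersetCard_nonempty.2 (by simpa using hkm))
  have hcard : s.card = k := (Finset.mem_powersetCard.1 hs).2
  have hswap : ∀ i ∈ s, ∀ j ∉ s, x j ≤ x i := by
    intro i hi j hj
    have hj' : j ∉ s.erase i := fun h => hj (Finset.mem_of_mem_erase h)
    have := hmax (insert j (s.erase i)) (by
      rw [Finset.mem_powersetCard]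
      refine ⟨Finset.subset_univ _, ?_⟩
      rw [Finset.card_insert_of_notMem hj', Finset.card_erase_of_mem hi]
      omega)
    rw [Finset.sum_insert hj'] at this
    have h2 := Finset.add_sum_erase s x hi
    linarith
  obtain ⟨i₀, hi₀, hmin⟩ := Finset.exists_min_image s x (Finset.card_pos.1 (by omega))
  have key : ∑ i, ν i * x i ≤ ∑ i, (if i ∈ s then (1 : ℝ) else 0) * x i := by
    refine sum_mul_le_sum_mul_of_threshold (x i₀) (by simp [hsum, hcard]) fun i => ?_
    split_ifs with hi
    · exact mul_nonpos_of_nonpos_of_nonneg (by linarith [h1 i]) (by linarith [hmin i hi])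
    · exact mul_nonpos_of_nonneg_of_nonpos (by linarith [h0 i])
        (by linarith [hswap i₀ hi₀ i hi])
  have h3 := sum_le_topkSum x s
  rw [hcard] at h3
  refine key.trans (le_trans (le_of_eq ?_) h3)
  simp

/-! ### Characterization of the projection onto `Bk` -/

lemma IsEProjOn.eq_of_variational {m : ℕ} {S : Set (Fin m → ℝ)} {z p q : Fin m → ℝ}
    (hp : IsEProjOn S z p) (hq : q ∈ S) (h : ∑ i, (z i - q i) * (p i - q i) ≤ 0) : p = q := by
  have h1 := hp.2 q hq
  have h2 : ∑ i, (z i - p i) ^ 2 = ∑ i, (z i - q i) ^ 2 + ∑ i, (p i - q i) ^ 2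
      - 2 * ∑ i, (z i - q i) * (p i - q i) := by
    rw [Finset.mul_sum, ← Finset.sum_add_distrib, ← Finset.sum_sub_distrib]
    exact Finset.sum_congr rfl fun i _ => by ring
  have h3 : ∑ i, (p i - q i) ^ 2 = 0 :=
    le_antisymm (by linarith) (Finset.sum_nonneg fun i _ => sq_nonneg _)
  rw [Finset.sum_eq_zero_iff_of_nonneg fun i _ => sq_nonneg _] at h3
  ext i
  have := h3 i (Finset.mem_univ i)
  linarith [pow_eq_zero_iff two_ne_zero |>.1 this]

/-- The point obtained from `z` by shifting the first `k0` entries by `-l`, setting the next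
`k1 - k0` entries to `t`, and keeping the others. -/
def blockShift {m : ℕ} (k0 k1 : ℕ) (l t : ℝ) (z : Fin m → ℝ) : Fin m → ℝ :=
  fun i => if (i : ℕ) < k0 then z i - l else if (i : ℕ) < k1 then t else z i

lemma IsEProjOn.eq_blockShift {m k k0 k1 : ℕ} (hk : 1 ≤ k) (hkm : k ≤ m) (h01 : k0 ≤ k1)
    (hk1m : k1 ≤ m) {z p : Fin m → ℝ} (hp : IsEProjOn (Bk m k) z p) {l t : ℝ} (hl : 0 < l)
    (hα : ∀ i : Fin m, (i : ℕ) < k0 → t < z i - l)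
    (hβ : ∀ i : Fin m, k0 ≤ (i : ℕ) → (i : ℕ) < k1 → z i - l < t ∧ t < z i)
    (hγ : ∀ i : Fin m, k1 ≤ (i : ℕ) → z i < t)
    (hsα : (k0 : ℝ) * l - ((k : ℝ) - k0) * t = ∑ i : Fin m, if (i : ℕ) < k0 then z i else 0)
    (hsβ : ((k : ℝ) - k0) * l + ((k1 : ℝ) - k0) * t =
      ∑ i : Fin m, if k0 ≤ (i : ℕ) ∧ (i : ℕ) < k1 then z i else 0) :
    p = blockShift k0 k1 l t z := by
  classical
  set q := blockShift k0 k1 l t z with hq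
  set ν : Fin m → ℝ := fun i => (z i - q i) / l with hν
  have hνl : ∀ i, z i - q i = l * ν i := fun i => by simp only [hν]; field_simp
  have cases : ∀ i : Fin m, (ν i = 1 ∧ t ≤ q i) ∨ (0 ≤ ν i ∧ ν i ≤ 1 ∧ q i = t) ∨
      (ν i = 0 ∧ q i ≤ t) := by
    intro i
    rcases lt_or_ge (i : ℕ) k0 with hi | hi
    · left
      have hqi : q i = z i - l := by simp [hq, blockShift, hi]
      refine ⟨?_, by linarith [hα i hi]⟩
      simp only [hν, hqi]
      field_simp
      ring
    rcases lt_or_ge (i : ℕ) k1 with hi' | hi'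
    · right; left
      have hqi : q i = t := by simp [hq, blockShift, hi', not_lt.2 hi]
      obtain ⟨h1, h2⟩ := hβ i hi hi'
      refine ⟨?_, ?_, hqi⟩
      · simp only [hν, hqi]
        exact div_nonneg (by linarith) hl.le
      · simp only [hν, hqi]
        rw [div_le_one hl]
        linarith
    · right; right
      have hqi : q i = z i := by simp [hq, blockShift, not_lt.2 hi, not_lt.2 hi']
      exact ⟨by simp [hν, hqi], by linarith [hγ i hi']⟩
  have hν0 : ∀ i, 0 ≤ ν i := fun i => by
    rcases cases i with h | h | h <;> linarith [h.1]
  have hν1 : ∀ i, ν i ≤ 1 := fun i => by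
    rcases cases i with h | h | h <;> linarith [h.1, h.2]
  have hνsum : ∑ i, ν i = k := by
    have h1 : ∑ i, l * ν i = (∑ i : Fin m, if (i : ℕ) < k0 then l else 0)
        + (∑ i : Fin m, if k0 ≤ (i : ℕ) ∧ (i : ℕ) < k1 then z i else 0)
        - ∑ i : Fin m, if k0 ≤ (i : ℕ) ∧ (i : ℕ) < k1 then t else 0 := by
      rw [← Finset.sum_add_distrib, ← Finset.sum_sub_distrib]
      refine Finset.sum_congr rfl fun i _ => ?_
      rw [← hνl]
      simp only [hq, blockShift]
      split_ifs <;> first | omega | ring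
    rw [← Finset.mul_sum, Fin.sum_ite_lt_const (h01.trans hk1m),
      Fin.sum_ite_between_const h01 hk1m, ← hsβ] at h1
    exact mul_left_cancel₀ hl.ne' (h1.trans (by ring))
  have hνq : ∑ i, ν i * q i = 0 := by
    have h1 : ∑ i, l * (ν i * q i) = l * ((∑ i : Fin m, if (i : ℕ) < k0 then z i else 0)
        - ∑ i : Fin m, if (i : ℕ) < k0 then l else 0)
        + t * ((∑ i : Fin m, if k0 ≤ (i : ℕ) ∧ (i : ℕ) < k1 then z i else 0)
        - ∑ i : Fin m, if k0 ≤ (i : ℕ) ∧ (i : ℕ) < k1 then t else 0) := by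
      rw [← Finset.sum_sub_distrib, ← Finset.sum_sub_distrib, Finset.mul_sum, Finset.mul_sum,
        ← Finset.sum_add_distrib]
      refine Finset.sum_congr rfl fun i _ => ?_
      rw [← mul_assoc, ← hνl]
      simp only [hq, blockShift]
      split_ifs <;> first | omega | ring
    rw [← Finset.mul_sum, Fin.sum_ite_lt_const (h01.trans hk1m),
      Fin.sum_ite_between_const h01 hk1m, ← hsβ, ← hsα] at h1
    exact mul_left_cancel₀ hl.ne' (h1.trans (by ring))
  have hqmem : q ∈ Bk m k := by
    obtain ⟨s₀, -, hs₀⟩ := Finset.exists_subset_card_eq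
      (s := (Finset.univ : Finset (Fin m))) (n := k) (by simpa using hkm)
    show topkSum k q ≤ 0
    refine csSup_le ⟨_, s₀, hs₀, rfl⟩ ?_
    rintro v ⟨s, hs, rfl⟩
    have h1 : ∑ i, (if i ∈ s then (1 : ℝ) else 0) * q i ≤ ∑ i, ν i * q i := by
      refine sum_mul_le_sum_mul_of_threshold t (by simp [hνsum, hs]) fun i => ?_
      rcases cases i with ⟨h, h'⟩ | ⟨-, -, h⟩ | ⟨h, h'⟩
      · exact mul_nonpos_of_nonpos_of_nonneg (by rw [h]; split_ifs <;> norm_num) (by linarith)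
      · simp [h]
      · exact mul_nonpos_of_nonneg_of_nonpos (by rw [h]; split_ifs <;> norm_num) (by linarith)
    rw [hνq] at h1
    simpa using h1
  refine hp.eq_of_variational hqmem ?_
  have hνp : ∑ i, ν i * p i ≤ 0 :=
    (sum_mul_le_topkSum hk (by simpa using hkm) p ν hν0 hν1 hνsum).trans hp.1
  have h1 : ∑ i, (z i - q i) * (p i - q i) = l * (∑ i, ν i * p i - ∑ i, ν i * q i) := by
    rw [← Finset.sum_sub_distrib, Finset.mul_sum]
    refine Finset.sum_congr rfl fun i _ => ?_
    rw [hνl]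
    ring
  rw [h1, hνq]
  nlinarith

/-! ### The matrix `Bmat` and the orthogonal projection onto its kernel -/

lemma Matrix.one_sub_mulVec_eq_of_orthogonal {p n : Type*} [Fintype p] [Fintype n]
    [DecidableEq p] [DecidableEq n] {B : Matrix p n ℝ} (hB : IsUnit (B * Bᵀ)) {x q : n → ℝ}
    (hq : B *ᵥ q = 0) (horth : ∀ w, B *ᵥ w = 0 → (x - q) ⬝ᵥ w = 0) :
    (1 - Bᵀ * (B * Bᵀ)⁻¹ * B) *ᵥ x = q := by
  have hdet : IsUnit (B * Bᵀ).det := (Matrix.isUnit_iff_isUnit_det _).1 hB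
  set R := 1 - Bᵀ * (B * Bᵀ)⁻¹ * B with hR
  have hBR : B * R = 0 := by
    rw [hR, Matrix.mul_sub, Matrix.mul_one, ← Matrix.mul_assoc, ← Matrix.mul_assoc,
      Matrix.mul_nonsing_inv _ hdet, Matrix.one_mul, sub_self]
  have hRq : R *ᵥ q = q := by
    rw [hR, Matrix.sub_mulVec, Matrix.one_mulVec, ← Matrix.mulVec_mulVec, hq,
      Matrix.mulVec_zero, sub_zero]
  set w := R *ᵥ (x - q) with hw
  have hBw : B *ᵥ w = 0 := by
    rw [hw, Matrix.mulVec_mulVec, hBR, Matrix.zero_mulVec]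
  have hw' : w = (x - q) - Bᵀ *ᵥ (((B * Bᵀ)⁻¹ * B) *ᵥ (x - q)) := by
    rw [hw, hR, Matrix.sub_mulVec, Matrix.one_mulVec, Matrix.mulVec_mulVec, Matrix.mul_assoc]
  have hww : w ⬝ᵥ w = 0 := by
    conv_lhs => enter [1]; rw [hw']
    rw [sub_dotProduct, horth w hBw, Matrix.mulVec_transpose, ← Matrix.dotProduct_mulVec, hBw,
      dotProduct_zero, sub_zero]
  have hw0 : w = 0 := dotProduct_self_eq_zero.1 hww
  have : R *ᵥ x = R *ᵥ q + w := by
    rw [hw, ← Matrix.mulVec_add, add_sub_cancel]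
  rw [this, hRq, hw0, add_zero]

lemma Bmat_mulVec_zero {a b : ℕ} (μβ : Fin b → ℝ) (x : Fin (a + b) → ℝ) (i : Fin b)
    (hi : (i : ℕ) = 0) :
    (Bmat a b μβ *ᵥ x) i =
      ∑ j, x (Fin.castAdd b j) + ∑ j, μβ j * x (Fin.natAdd a j) := by
  simp [Matrix.mulVec, dotProduct, Fin.sum_univ_add, Bmat, hi]

lemma Bmat_mulVec_succ {a b : ℕ} (μβ : Fin b → ℝ) (x : Fin (a + b) → ℝ) (n : ℕ)
    (hn : n + 1 < b) :
    (Bmat a b μβ *ᵥ x) ⟨n + 1, hn⟩ =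
      x (Fin.natAdd a ⟨n, by omega⟩) - x (Fin.natAdd a ⟨n + 1, hn⟩) := by
  have h : ∀ j : Fin b, (if (j : ℕ) = n then (1 : ℝ) else if (j : ℕ) = n + 1 then -1 else 0) *
      x (Fin.natAdd a j) = (if j = ⟨n, by omega⟩ then x (Fin.natAdd a j) else 0) -
        (if j = ⟨n + 1, hn⟩ then x (Fin.natAdd a j) else 0) := by
    intro j
    simp only [Fin.ext_iff]
    split_ifs <;> first | omega | simp
  have h' : (Bmat a b μβ *ᵥ x) ⟨n + 1, hn⟩ = ∑ j : Fin b,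
      (if (j : ℕ) = n then (1 : ℝ) else if (j : ℕ) = n + 1 then -1 else 0) *
        x (Fin.natAdd a j) := by
    simp [Matrix.mulVec, dotProduct, Fin.sum_univ_add, Bmat, Cmat]
  rw [h', Finset.sum_congr rfl fun j _ => h j, Finset.sum_sub_distrib, Finset.sum_ite_eq',
    Finset.sum_ite_eq', if_pos (Finset.mem_univ _), if_pos (Finset.mem_univ _)]

lemma Bmat_mulVec_eq_zero_iff {a b : ℕ} (hb : 0 < b) (μβ : Fin b → ℝ) (x : Fin (a + b) → ℝ) :
    Bmat a b μβ *ᵥ x = 0 ↔ ∃ t, (∀ j, x (Fin.natAdd a j) = t) ∧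
      ∑ j, x (Fin.castAdd b j) + (∑ j, μβ j) * t = 0 := by
  constructor
  · intro h
    have hc : ∀ n (hn : n < b), x (Fin.natAdd a ⟨n, hn⟩) = x (Fin.natAdd a ⟨0, hb⟩) := by
      intro n
      induction n with
      | zero => intro _; rfl
      | succ n ih =>
        intro hn
        have h1 := congrFun h ⟨n + 1, hn⟩
        rw [Bmat_mulVec_succ, Pi.zero_apply] at h1
        linarith [ih (by omega)]
    refine ⟨_, fun j => hc j j.2, ?_⟩
    have h0 := congrFun h ⟨0, hb⟩
    rw [Bmat_mulVec_zero _ _ _ rfl, Pi.zero_apply] at h0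
    rw [Finset.sum_mul, ← h0]
    congr 1
    exact Finset.sum_congr rfl fun j _ => by rw [← hc j j.2]
  · rintro ⟨t, hc, hs⟩
    ext ⟨i, hi⟩
    rcases i with _ | n
    · rw [Bmat_mulVec_zero _ _ _ rfl]
      simpa [hc, ← Finset.sum_mul] using hs
    · rw [Bmat_mulVec_succ, hc, hc, sub_self, Pi.zero_apply]

lemma isUnit_Bmat_mul_transpose {a b : ℕ} (hb : 0 < b) (μβ : Fin b → ℝ)
    (hμ : ∑ j, μβ j ≠ 0) : IsUnit (Bmat a b μβ * (Bmat a b μβ)ᵀ) := by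
  rw [← Matrix.mulVec_injective_iff_isUnit]
  refine (injective_iff_map_eq_zero (Matrix.mulVecLin _)).2 fun w hw => ?_
  set B := Bmat a b μβ
  have hBw : Bᵀ *ᵥ w = 0 := by
    rw [← dotProduct_self_eq_zero]
    conv_lhs => enter [1]; rw [Matrix.mulVec_transpose]
    rw [← Matrix.dotProduct_mulVec, Matrix.mulVec_mulVec, ← Matrix.mulVecLin_apply, hw,
      dotProduct_zero]
  have hdot : ∀ x, ∑ i, w i * (B *ᵥ x) i = 0 := fun x => by
    have : w ⬝ᵥ (B *ᵥ x) = 0 := by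
      rw [Matrix.dotProduct_mulVec, ← Matrix.mulVec_transpose, hBw, zero_dotProduct]
    exact this
  -- Test against the indicators of the final segments of the second block.
  let e : ℕ → Fin (a + b) → ℝ := fun n j => if a + n ≤ (j : ℕ) then 1 else 0
  have hrow : ∀ n l (hl : l + 1 < b), (B *ᵥ e n) ⟨l + 1, hl⟩ = if l + 1 = n then -1 else 0 := by
    intro n l hl
    rw [Bmat_mulVec_succ]
    simp only [e, Fin.val_natAdd]
    split_ifs <;> first | omega | norm_num
  have hw0 : w ⟨0, hb⟩ = 0 := by
    have h := hdot (e 0)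
    rw [Finset.sum_eq_single ⟨0, hb⟩] at h
    · rw [Bmat_mulVec_zero _ _ _ rfl] at h
      have h1 : ∀ j : Fin a, e 0 (Fin.castAdd b j) = 0 := fun j => by simp [e]
      have h2 : ∀ j : Fin b, e 0 (Fin.natAdd a j) = 1 := fun j => by simp [e]
      simp only [h1, h2, Finset.sum_const_zero, mul_one, zero_add] at h
      exact (mul_eq_zero.1 h).resolve_right hμ
    · rintro ⟨i, hi⟩ - hne
      rcases i with _ | l
      · exact absurd rfl hne
      · simp [hrow]
    · simp
  ext ⟨i, hi⟩
  rcases i with _ | n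
  · exact hw0
  · have h := hdot (e (n + 1))
    rw [Finset.sum_eq_single ⟨n + 1, hi⟩] at h
    · rw [hrow] at h
      simpa using h
    · rintro ⟨i, hi'⟩ - hne
      rcases i with _ | l
      · simp [hw0]
      · rw [hrow, if_neg (by simpa using hne), mul_zero]
    · simp

lemma Bmat_projection_mulVec {m k k0 k1 : ℕ} (h01 : k0 < k1) (hk1m : k1 ≤ m)
    (μβ : Fin (k1 - k0) → ℝ) (hμ : ∑ j, μβ j = (k : ℝ) - k0)
    (hB : IsUnit (Bmat k0 (k1 - k0) μβ * (Bmat k0 (k1 - k0) μβ)ᵀ))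
    {z : Fin m → ℝ} {l t : ℝ}
    (hsα : (k0 : ℝ) * l - ((k : ℝ) - k0) * t = ∑ i : Fin m, if (i : ℕ) < k0 then z i else 0)
    (hsβ : ((k : ℝ) - k0) * l + ((k1 : ℝ) - k0) * t =
      ∑ i : Fin m, if k0 ≤ (i : ℕ) ∧ (i : ℕ) < k1 then z i else 0) :
    ((1 : Matrix (Fin (k0 + (k1 - k0))) (Fin (k0 + (k1 - k0))) ℝ) -
      (Bmat k0 (k1 - k0) μβ)ᵀ * (Bmat k0 (k1 - k0) μβ * (Bmat k0 (k1 - k0) μβ)ᵀ)⁻¹ *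
        Bmat k0 (k1 - k0) μβ) *ᵥ (fun j => z ⟨j, by omega⟩) =
      fun j : Fin (k0 + (k1 - k0)) => blockShift k0 k1 l t z ⟨j, by omega⟩ := by
  have hα : ∑ j : Fin k0, z ⟨j, by omega⟩ = (k0 : ℝ) * l - ((k : ℝ) - k0) * t := by
    rw [hsα]
    simpa using (Fin.sum_dite_lt (h01.le.trans hk1m) (fun j => z ⟨j, by omega⟩)).symm
  have hβ : ∑ j : Fin (k1 - k0), z ⟨k0 + j, by omega⟩ =
      ((k : ℝ) - k0) * l + ((k1 : ℝ) - k0) * t := by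
    rw [hsβ, Fin.sum_ite_between_eq h01.le hk1m]
  have hqα : ∀ j : Fin k0, blockShift k0 k1 l t z ⟨j, by omega⟩ = z ⟨j, by omega⟩ - l :=
    fun j => by simp [blockShift]
  have hqβ : ∀ j : Fin (k1 - k0), blockShift k0 k1 l t z ⟨k0 + j, by omega⟩ = t := fun j => by
    have : k0 + (j : ℕ) < k1 := by omega
    simp [blockShift, this]
  refine Matrix.one_sub_mulVec_eq_of_orthogonal hB ?_ fun w hw => ?_
  · rw [Bmat_mulVec_eq_zero_iff (by omega)]
    refine ⟨t, fun j => hqβ j, ?_⟩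
    simp only [Fin.val_castAdd, hqα, Finset.sum_sub_distrib, hα, hμ]
    simp
  · obtain ⟨s, hs, hsum⟩ := (Bmat_mulVec_eq_zero_iff (by omega) _ _).1 hw
    rw [dotProduct, Fin.sum_univ_add]
    simp only [Pi.sub_apply, Fin.val_castAdd, Fin.val_natAdd, hqα, hqβ, hs, sub_sub_cancel]
    rw [← Finset.mul_sum, ← Finset.sum_mul, Finset.sum_sub_distrib, hβ]
    rw [hμ] at hsum
    simp only [Finset.sum_const, Finset.card_univ, Fintype.card_fin, nsmul_eq_mul,
      Nat.cast_sub h01.le]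
    linear_combination l * hsum

/-- Lemma 2.2, case b: sorted `y` with `T_k(y) > 0`, projection `ȳ` with index
pair `(k̄0, k̄1)`, KKT multipliers, `k < k̄1` and `y_{k̄0+1} - λ̄ < θ̄ < y_{k̄1}`.  Then with
`B = [1_ᾱᵀ μ̄_β̄ᵀ ; 0 C]`, the matrix `B Bᵀ` is invertible and the Jacobian of `proj_{B_k}`
at `y` is `diag(I - Bᵀ(B Bᵀ)⁻¹B, I_{|γ̄|})`. -/
theorem proj_jacobian_case_b
    (m k : ℕ) (hk1 : 1 ≤ k) (hkm : k ≤ m)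
    (P : (Fin m → ℝ) → (Fin m → ℝ)) (hP : ∀ z, IsEProjOn (Bk m k) z (P z))
    (y ybar : Fin m → ℝ) (hsorted : Antitone y) (hpos : 0 < topkSum k y)
    (hybar : P y = ybar)
    (μ : Fin m → ℝ) (lam θ : ℝ) (k0 k1 : ℕ)
    (hk0 : k0 < k) (hkk1 : k ≤ k1) (hk1m : k1 ≤ m)
    (hkkt : ProjKKT k y ybar μ lam θ k0 k1)
    (hklt : k < k1) (hlow : ent y (k0 + 1) - lam < θ) (hhigh : θ < ent y k1)
    (μβ : Fin (k1 - k0) → ℝ)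
    (hμβ : ∀ j : Fin (k1 - k0), μβ j = μ ⟨k0 + (j : ℕ), by have := j.isLt; omega⟩) :
    IsUnit (Bmat k0 (k1 - k0) μβ * (Bmat k0 (k1 - k0) μβ)ᵀ) ∧
    HasFDerivAt P
      (LinearMap.toContinuousLinearMap (Matrix.mulVecLin (Matrix.of fun i j : Fin m =>
        if h : (i : ℕ) < k1 ∧ (j : ℕ) < k1 then
          ((1 : Matrix (Fin (k0 + (k1 - k0))) (Fin (k0 + (k1 - k0))) ℝ)
              - (Bmat k0 (k1 - k0) μβ)ᵀ *
                  (Bmat k0 (k1 - k0) μβ * (Bmat k0 (k1 - k0) μβ)ᵀ)⁻¹ *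
                  Bmat k0 (k1 - k0) μβ)
            ⟨(i : ℕ), by have := h.1; omega⟩ ⟨(j : ℕ), by have := h.2; omega⟩
        else if i = j then 1 else 0))) y := by
  obtain ⟨-, hKα, hKβ, hKμ, hKγ, hKsum, hlam, hθlow, hθhigh⟩ := hkkt
  have h01 : k0 < k1 := hk0.trans hklt
  have hμsum : ∑ j, μβ j = (k : ℝ) - k0 := by
    rw [← hKμ, Fin.sum_ite_between_eq h01.le hk1m]
    exact Finset.sum_congr rfl fun j _ => hμβ j
  have hr : (0 : ℝ) < (k : ℝ) - k0 := sub_pos.2 (by exact_mod_cast hk0)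
  have hb : (0 : ℝ) < (k1 : ℝ) - k0 := sub_pos.2 (by exact_mod_cast h01)
  have hB : IsUnit (Bmat k0 (k1 - k0) μβ * (Bmat k0 (k1 - k0) μβ)ᵀ) :=
    isUnit_Bmat_mul_transpose (by omega) μβ (by rw [hμsum]; exact hr.ne')
  refine ⟨hB, ?_⟩
  -- Near `y`, both multipliers are linear functions of the point being projected.
  let Sα : (Fin m → ℝ) → ℝ := fun z => ∑ i : Fin m, if (i : ℕ) < k0 then z i else 0
  let Sβ : (Fin m → ℝ) → ℝ := fun z =>
    ∑ i : Fin m, if k0 ≤ (i : ℕ) ∧ (i : ℕ) < k1 then z i else 0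
  let D : ℝ := k0 * ((k1 : ℝ) - k0) + ((k : ℝ) - k0) ^ 2
  have hD : 0 < D := by positivity
  let L : (Fin m → ℝ) → ℝ := fun z => (((k1 : ℝ) - k0) * Sα z + ((k : ℝ) - k0) * Sβ z) / D
  let T : (Fin m → ℝ) → ℝ := fun z => (k0 * Sβ z - ((k : ℝ) - k0) * Sα z) / D
  have hSα : ∀ z, (k0 : ℝ) * L z - ((k : ℝ) - k0) * T z = Sα z := fun z => by
    simp only [L, T]
    field_simp
    simp only [D]
    ring
  have hSβ : ∀ z, ((k : ℝ) - k0) * L z + ((k1 : ℝ) - k0) * T z = Sβ z := fun z => by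
    simp only [L, T]
    field_simp
    simp only [D]
    ring
  have hSαc : Continuous Sα := continuous_finsetSum _ fun i _ => by
    split_ifs <;> fun_prop
  have hSβc : Continuous Sβ := continuous_finsetSum _ fun i _ => by
    split_ifs <;> fun_prop
  have hLc : Continuous L := by fun_prop
  have hTc : Continuous T := by fun_prop
  have hSαy : Sα y = k0 * lam - ((k : ℝ) - k0) * θ := by linarith
  have hSβy : Sβ y = ((k : ℝ) - k0) * lam + ((k1 : ℝ) - k0) * θ := by
    have : Sβ y = (∑ i : Fin m, if k0 ≤ (i : ℕ) ∧ (i : ℕ) < k1 then θ else 0) + lam *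
        ∑ i : Fin m, if k0 ≤ (i : ℕ) ∧ (i : ℕ) < k1 then μ i else 0 := by
      rw [Finset.mul_sum, ← Finset.sum_add_distrib]
      refine Finset.sum_congr rfl fun i _ => ?_
      split_ifs with hi
      · have := hKβ i hi.1 hi.2
        linarith [this.1, this.2.1]
      · simp
    rw [this, hKμ, Fin.sum_ite_between_const h01.le hk1m]
    ring
  have hLy : L y = lam := by
    simp only [L, hSαy, hSβy]
    field_simp
    simp only [D]
    ring
  have hTy : T y = θ := by
    simp only [T, hSαy, hSβy]
    field_simp
    simp only [D]
    ring
  have hyα : ∀ i : Fin m, (i : ℕ) < k0 → θ < y i - lam := by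
    intro i hi
    have hk0m : k0 ≤ m := h01.le.trans hk1m
    rw [entE, dif_pos ⟨by omega, hk0m⟩, EReal.coe_lt_coe_iff,
      (hKα ⟨k0 - 1, by omega⟩ (by simp only; omega)).1] at hθlow
    have := hsorted (show i ≤ ⟨k0 - 1, by omega⟩ from Fin.le_def.2 (by simp only; omega))
    linarith
  have hyβ : ∀ i : Fin m, k0 ≤ (i : ℕ) → (i : ℕ) < k1 → y i - lam < θ ∧ θ < y i := by
    intro i hi hi'
    rw [ent, dif_pos ⟨by omega, by omega⟩] at hlow hhigh
    have h1 := hsorted (show ⟨k0 + 1 - 1, by omega⟩ ≤ i from Fin.le_def.2 (by simpa using hi))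
    have h2 := hsorted (show i ≤ ⟨k1 - 1, by omega⟩ from Fin.le_def.2 (by simp only; omega))
    constructor <;> linarith
  have hyγ : ∀ i : Fin m, k1 ≤ (i : ℕ) → y i < θ := by
    intro i hi
    rw [entE, dif_pos ⟨by omega, by omega⟩, EReal.coe_lt_coe_iff,
      (hKγ ⟨k1 + 1 - 1, by omega⟩ (by simp)).1] at hθhigh
    have := hsorted (show ⟨k1 + 1 - 1, by omega⟩ ≤ i from Fin.le_def.2 (by simpa using hi))
    linarith
  have hev : ∀ᶠ z in 𝓝 y, P z = blockShift k0 k1 (L z) (T z) z := by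
    have eL : ∀ᶠ z in 𝓝 y, 0 < L z :=
      continuousAt_const.eventually_lt hLc.continuousAt (by rwa [hLy])
    have eα : ∀ᶠ z in 𝓝 y, ∀ i : Fin m, (i : ℕ) < k0 → T z < z i - L z := by
      refine eventually_all.2 fun i => eventually_imp_distrib_left.2 fun hi => ?_
      exact hTc.continuousAt.eventually_lt (by fun_prop) (by rw [hTy, hLy]; exact hyα i hi)
    have eβ : ∀ᶠ z in 𝓝 y, ∀ i : Fin m, k0 ≤ (i : ℕ) → (i : ℕ) < k1 →
        z i - L z < T z ∧ T z < z i := by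
      refine eventually_all.2 fun i => eventually_imp_distrib_left.2 fun hi =>
        eventually_imp_distrib_left.2 fun hi' => ?_
      refine Filter.Eventually.and ?_ ?_
      · exact ContinuousAt.eventually_lt (by fun_prop) hTc.continuousAt
          (by rw [hTy, hLy]; exact (hyβ i hi hi').1)
      · exact hTc.continuousAt.eventually_lt (continuous_apply i).continuousAt
          (by rw [hTy]; exact (hyβ i hi hi').2)
    have eγ : ∀ᶠ z in 𝓝 y, ∀ i : Fin m, k1 ≤ (i : ℕ) → z i < T z := by
      refine eventually_all.2 fun i => eventually_imp_distrib_left.2 fun hi => ?_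
      exact (continuous_apply i).continuousAt.eventually_lt hTc.continuousAt
        (by rw [hTy]; exact hyγ i hi)
    filter_upwards [eL, eα, eβ, eγ] with z zL zα zβ zγ
    exact (hP z).eq_blockShift hk1 hkm h01.le hk1m zL zα zβ zγ (hSα z) (hSβ z)
  refine (ContinuousLinearMap.hasFDerivAt _).congr_of_eventuallyEq ?_
  filter_upwards [hev] with z hz
  rw [hz]
  have hproj := Bmat_projection_mulVec h01 hk1m μβ hμsum hB (hSα z) (hSβ z)
  ext i
  rw [LinearMap.coe_toContinuousLinearMap', Matrix.mulVecLin_apply, Matrix.mulVec, dotProduct]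
  simp only [Matrix.of_apply]
  rcases lt_or_ge (i : ℕ) k1 with hi | hi
  · have hn : k0 + (k1 - k0) = k1 := by omega
    have h1 := congrFun hproj ⟨i, by omega⟩
    rw [Matrix.mulVec, dotProduct, ← Fin.sum_dite_lt (hn.le.trans hk1m)] at h1
    refine h1.symm.trans (Finset.sum_congr rfl fun j _ => ?_)
    by_cases hj : (j : ℕ) < k1
    · rw [dif_pos (hj.trans_eq hn.symm), dif_pos ⟨hi, hj⟩]
    · have hij : i ≠ j := fun h => hj (h ▸ hi)
      rw [dif_neg (by omega), dif_neg (fun h => hj h.2), if_neg hij, zero_mul]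
  · have h1 : ¬ (i : ℕ) < k0 := by omega
    simp [blockShift, h1, not_lt.2 hi]
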